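/- Let X ⊆ [n], let x be the element of ᴵW corresponding to X, and let E ⊆ E(X). Then the 1-2-1 shapes of distinct elements of E(X) are pairwise disjoint sets of boxes of the shifted tableau of X, so the subexpression e(E) of the column reduced expression of X is well defined. The subexpression e(E) is I-parabolic, has defect 0, and has no position p with e_p = 1 and ℓ(x_{p−1}σ_p) < ℓ(x_{p−1}); moreover its product is the element of ᴵW corresponding to X ∖ E. -/

import Mathlib

open List

/-- The Coxeter matrix of type `Bₙ` with the 4-bond between `s₀` and `s₁`. -/
def BCox (n : ℕ) : CoxeterMatrix (Fin n) where
  M := Matrix.of fun i j : Fin n ↦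
    if i = j then 1
      else if (i : ℕ) + (j : ℕ) = 1 then 4
      else if (j : ℕ) + 1 = (i : ℕ) ∨ (i : ℕ) + 1 = (j : ℕ) then 3 else 2
  isSymm := by
    unfold Matrix.IsSymm
    ext i j
    simp only [Matrix.transpose_apply, Matrix.of_apply]
    rcases eq_or_ne i j with h | h
    · subst h; simp
    · rw [if_neg h, if_neg (Ne.symm h)]
      split_ifs <;> omega
  diagonal := by simp
  off_diagonal := by
    intro i j hij
    simp only [Matrix.of_apply, if_neg hij]
    split_ifs <;> simp

/-- The right action of the generator `sᵢ` on subsets of `{1, …, n}`: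
`s₀` toggles membership of `1`; for `i ≥ 1`, `sᵢ` interchanges the membership
status of `i` and `i + 1`. -/
def bAct (n : ℕ) (X : Finset ℕ) (i : Fin n) : Finset ℕ :=
  if (i : ℕ) = 0 then (if 1 ∈ X then X.erase 1 else insert 1 X)
  else if (i : ℕ) ∈ X ∧ (i : ℕ) + 1 ∉ X then insert ((i : ℕ) + 1) (X.erase (i : ℕ))
  else if (i : ℕ) + 1 ∈ X ∧ (i : ℕ) ∉ X then insert (i : ℕ) (X.erase ((i : ℕ) + 1))
  else X

/-- The set `ᴵW` of minimal length representatives of the cosets `W_I∖W`,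
where `I = {s₁, …, s_{n−1}}`. -/
def IWset {n : ℕ} {W : Type*} [Group W] (cs : CoxeterSystem (BCox n) W) : Set W :=
  {x | ∀ i : Fin n, (i : ℕ) ≠ 0 → cs.length x < cs.length (cs.simple i * x)}

/-- `x` corresponds to the subset `X ⊆ {1, …, n}` under the bijection `ᴵW ≅ 𝒫([n])`;
that is, `X = ∅ · x` for the right action of `W` on subsets. -/
def corr {n : ℕ} {W : Type*} [Group W] (cs : CoxeterSystem (BCox n) W) (x : W)
    (X : Finset ℕ) : Prop :=
  ∃ w : List (Fin n), cs.wordProd w = x ∧ w.foldl (bAct n) ∅ = X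

open Classical in
/-- The set `E(X)`: those even `t ∈ X` such that for every `k` with `t > k ≥ 1` there are
strictly more elements `t'` of `X` with `t > t' ≥ k` than elements `t'` of `[n] ∖ X` with
`t > t' ≥ k`. -/
noncomputable def Eset (n : ℕ) (X : Finset ℕ) : Finset ℕ :=
  X.filter fun t => Even t ∧ ∀ k ∈ Finset.Ico 1 t,
    ((X.filter fun t' => k ≤ t' ∧ t' < t).card
      > ((Finset.Icc 1 n \ X).filter fun t' => k ≤ t' ∧ t' < t).card)

/-- The boxes `(i, c)` (row `i`, 0-based; column `c`, 1-based) of the shifted tableau of the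
strictly decreasing list `T`, listed column by column from left to right and, within each
column, from top to bottom. Row `i` occupies the columns `2i + 1, …, 2i + T[i]`. -/
def boxes (T : List ℕ) : List (ℕ × ℕ) :=
  (List.range' 1 (2 * T.length + T.headD 0)).flatMap fun c =>
    (List.range T.length).filterMap fun i =>
      if 2 * i < c ∧ c ≤ 2 * i + T.getD i 0 then some (i, c) else none

/-- The column reduced expression of `T`: reading the labels of the shifted tableau column by
column from left to right and, within each column, from top to bottom; the box of row `i` in
column `c` carries the label `c − 2i − 1`. -/
def colWord (n : ℕ) (T : List ℕ) : List (Fin n) :=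
  (boxes T).filterMap fun b =>
    if h : b.2 - 2 * b.1 - 1 < n then some (⟨b.2 - 2 * b.1 - 1, h⟩ : Fin n) else none

/-- The box `(i, c)` of the shifted tableau of `T` belongs to the 1-2-1 shape of `t`,
where `t` occurs in `T` at some (0-based) row `i0`: the shape consists of the box labelled
`t − 1` in row `i0`, the boxes labelled `t − 2j − 1` and `t − 2j` in row `i0 + j` for
`0 < j < t/2`, and the box labelled `0` in row `i0 + t/2`. -/
def InShape (T : List ℕ) (t i c : ℕ) : Prop :=
  ∃ i0 ∈ Finset.range T.length, T.getD i0 0 = t ∧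
    ((i = i0 ∧ c = 2 * i + t) ∨
     (i0 < i ∧ i < i0 + t / 2 ∧
       (c + 2 * (i - i0) = 2 * i + t ∨ c + 2 * (i - i0) = 2 * i + t + 1)) ∨
     (i = i0 + t / 2 ∧ c = 2 * i + 1))

instance (T : List ℕ) (t i c : ℕ) : Decidable (InShape T t i c) := by
  unfold InShape; infer_instance

/-- The subexpression `e(E)` of the column reduced expression of `T`, as a list of booleans:
`false` (i.e. `0`) exactly at the positions coming from boxes belonging to the 1-2-1 shape of
some `t ∈ E`, and `true` (i.e. `1`) elsewhere. -/
def colMask (n : ℕ) (T : List ℕ) (E : Finset ℕ) : List Bool :=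
  (boxes T).filterMap fun b =>
    if b.2 - 2 * b.1 - 1 < n then some (decide ¬ ∃ t ∈ E, InShape T t b.1 b.2) else none

/-- Auxiliary: the product of a subexpression, with prefix products starting at `x`. -/
def subProdAux {n : ℕ} {W : Type*} [Group W] (cs : CoxeterSystem (BCox n) W) :
    W → List (Fin n × Bool) → W
  | x, [] => x
  | x, (i, b) :: rest => subProdAux cs (if b then x * cs.simple i else x) rest

/-- The product `x_m` of the subexpression `e` of the word `u`. -/
def subProd {n : ℕ} {W : Type*} [Group W] (cs : CoxeterSystem (BCox n) W)
    (u : List (Fin n)) (e : List Bool) : W :=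
  subProdAux cs 1 (u.zip e)

/-- Auxiliary: the subexpression (with prefix products starting at `x`) is parabolic with
respect to the set `P`. -/
def IsParAux {n : ℕ} {W : Type*} [Group W] (cs : CoxeterSystem (BCox n) W) (P : Set W) :
    W → List (Fin n × Bool) → Prop
  | _, [] => True
  | x, (i, b) :: rest =>
      x * cs.simple i ∈ P ∧ IsParAux cs P (if b then x * cs.simple i else x) rest

/-- The subexpression `e` of the word `u` is parabolic with respect to the set `P` of minimal
coset representatives: `x_{p−1} σ_p ∈ P` for every position `p`. -/
def IsPara {n : ℕ} {W : Type*} [Group W] (cs : CoxeterSystem (BCox n) W) (P : Set W)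
    (u : List (Fin n)) (e : List Bool) : Prop :=
  IsParAux cs P 1 (u.zip e)

/-- Auxiliary: the defect of a subexpression, with prefix products starting at `x`. -/
noncomputable def defectAux {n : ℕ} {W : Type*} [Group W] (cs : CoxeterSystem (BCox n) W) :
    W → List (Fin n × Bool) → ℤ
  | _, [] => 0
  | x, (i, b) :: rest =>
      if b then defectAux cs (x * cs.simple i) rest
      else (if cs.length x < cs.length (x * cs.simple i) then 1 else -1) + defectAux cs x rest

/-- The defect of the subexpression `e` of the word `u`:
`#{p : e_p = 0, ℓ(x_{p−1}σ_p) > ℓ(x_{p−1})} − #{p : e_p = 0, ℓ(x_{p−1}σ_p) < ℓ(x_{p−1})}`. -/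
noncomputable def defect {n : ℕ} {W : Type*} [Group W] (cs : CoxeterSystem (BCox n) W)
    (u : List (Fin n)) (e : List Bool) : ℤ :=
  defectAux cs 1 (u.zip e)

/-- Auxiliary: no position of the subexpression has `e_p = 1` and
`ℓ(x_{p−1} σ_p) < ℓ(x_{p−1})`. -/
def NoDownOneAux {n : ℕ} {W : Type*} [Group W] (cs : CoxeterSystem (BCox n) W) :
    W → List (Fin n × Bool) → Prop
  | _, [] => True
  | x, (i, b) :: rest =>
      (b = true → ¬ cs.length (x * cs.simple i) < cs.length x) ∧
      NoDownOneAux cs (if b then x * cs.simple i else x) rest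

/-- The subexpression `e` of `u` has no position `p` with `e_p = 1` and
`ℓ(x_{p−1} σ_p) < ℓ(x_{p−1})`. -/
def NoDownOne {n : ℕ} {W : Type*} [Group W] (cs : CoxeterSystem (BCox n) W)
    (u : List (Fin n)) (e : List Bool) : Prop :=
  NoDownOneAux cs 1 (u.zip e)

/-! ### The Coxeter group part -/

lemma mem_bAct {n : ℕ} (X : Finset ℕ) (i : Fin n) (v : ℕ) :
    v ∈ bAct n X i ↔
      if (i : ℕ) = 0 then (if v = 1 then 1 ∉ X else v ∈ X)
      else (if v = (i : ℕ) then (i : ℕ) + 1 ∈ X else if v = (i : ℕ) + 1 then (i : ℕ) ∈ X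
        else v ∈ X) := by
  unfold bAct
  split_ifs <;> simp_all <;> grind

def UpS {n : ℕ} (Y : Finset ℕ) (i : Fin n) : Prop :=
  if (i : ℕ) = 0 then 1 ∉ Y else (i : ℕ) ∈ Y ∧ (i : ℕ) + 1 ∉ Y

def DnS {n : ℕ} (Y : Finset ℕ) (i : Fin n) : Prop :=
  if (i : ℕ) = 0 then 1 ∈ Y else (i : ℕ) + 1 ∈ Y ∧ (i : ℕ) ∉ Y

lemma bAct_invol {n : ℕ} (X : Finset ℕ) (i : Fin n) : bAct n (bAct n X i) i = X := by
  ext v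
  simp only [mem_bAct]
  split_ifs <;> grind

lemma sum_up {n : ℕ} {Y : Finset ℕ} {i : Fin n} (h : UpS Y i) :
    (bAct n Y i).sum id = Y.sum id + 1 := by
  unfold UpS at h
  unfold bAct
  by_cases h0 : (i : ℕ) = 0
  · simp only [h0, if_true] at h ⊢
    rw [if_neg h, Finset.sum_insert h]
    simp [add_comm]
  · simp only [h0, if_false] at h ⊢
    rw [if_pos h, Finset.sum_insert (by simp [h.2]), ← Finset.add_sum_erase _ _ h.1]
    simp; ring

lemma up_of_dn {n : ℕ} {Y : Finset ℕ} {i : Fin n} (h : DnS Y i) : UpS (bAct n Y i) i := by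
  unfold DnS at h
  unfold UpS
  simp only [mem_bAct]
  split_ifs at * <;> simp_all

lemma sum_dn {n : ℕ} {Y : Finset ℕ} {i : Fin n} (h : DnS Y i) :
    (bAct n Y i).sum id + 1 = Y.sum id := by
  have := sum_up (up_of_dn h)
  rw [bAct_invol] at this
  exact this.symm

lemma bAct_fix {n : ℕ} {Y : Finset ℕ} {i : Fin n} (h : ¬ UpS Y i) (h' : ¬ DnS Y i) :
    bAct n Y i = Y := by
  unfold UpS at h
  unfold DnS at h'
  unfold bAct
  split_ifs at * <;> simp_all

lemma sum_le_succ {n : ℕ} (Y : Finset ℕ) (i : Fin n) :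
    (bAct n Y i).sum id ≤ Y.sum id + 1 := by
  by_cases h : UpS Y i
  · exact (sum_up h).le
  by_cases h' : DnS Y i
  · have := sum_dn h'; omega
  · rw [bAct_fix h h']; omega

lemma dn_of_lt {n : ℕ} {Y : Finset ℕ} {i : Fin n} (h : (bAct n Y i).sum id < Y.sum id) :
    DnS Y i := by
  by_contra h'
  by_cases h2 : UpS Y i
  · have := sum_up h2; omega
  · rw [bAct_fix h2 h'] at h; omega

def genPerm (n : ℕ) (i : Fin n) : Equiv.Perm (Finset ℕ) where
  toFun X := bAct n X i
  invFun X := bAct n X i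
  left_inv X := bAct_invol X i
  right_inv X := bAct_invol X i

lemma genPerm_apply {n : ℕ} (i : Fin n) (X : Finset ℕ) : genPerm n i X = bAct n X i := rfl

lemma genPerm_inv {n : ℕ} (i : Fin n) : (genPerm n i)⁻¹ = genPerm n i := rfl

lemma genPerm_liftable (n : ℕ) : (BCox n).IsLiftable (genPerm n) := by
  intro i j
  have hM : (BCox n).M i j = if i = j then 1
      else if (i : ℕ) + (j : ℕ) = 1 then 4
      else if (j : ℕ) + 1 = (i : ℕ) ∨ (i : ℕ) + 1 = (j : ℕ) then 3 else 2 := rfl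
  rw [hM]
  split_ifs with h1 h2 h3
  · subst h1
    ext X v
    simp [genPerm_apply, bAct_invol]
  · have hh : ((i : ℕ) = 0 ∧ (j : ℕ) = 1) ∨ ((i : ℕ) = 1 ∧ (j : ℕ) = 0) := by omega
    ext X v
    simp only [pow_succ, pow_zero, one_mul, Equiv.Perm.mul_apply, Equiv.Perm.one_apply,
      genPerm_apply]
    rcases hh with ⟨a, b⟩ | ⟨a, b⟩
    · by_cases v1 : v = 1
      · subst v1; simp [mem_bAct, a, b]
      by_cases v2 : v = 2
      · subst v2; simp [mem_bAct, a, b]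
      simp [mem_bAct, a, b, v1, v2]
    · by_cases v1 : v = 1
      · subst v1; simp [mem_bAct, a, b]
      by_cases v2 : v = 2
      · subst v2; simp [mem_bAct, a, b]
      simp [mem_bAct, a, b, v1, v2]
  · ext X v
    simp only [pow_succ, pow_zero, one_mul, Equiv.Perm.mul_apply, Equiv.Perm.one_apply,
      genPerm_apply]
    rcases h3 with h | h
    · have hj : (j : ℕ) ≠ 0 := by omega
      have q1 : ¬ (j : ℕ) + 1 + 1 = j := by omega
      have q2 : ¬ (j : ℕ) = j + 1 + 1 := by omega
      by_cases v1 : v = j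
      · subst v1; simp [mem_bAct, ← h, hj, q1, q2]
      by_cases v2 : v = j + 1
      · subst v2; simp [mem_bAct, ← h, hj, q1, q2]
      by_cases v3 : v = j + 1 + 1
      · subst v3; simp [mem_bAct, ← h, hj, q1, q2]
      simp [mem_bAct, ← h, hj, v1, v2, v3]
    · have hj : (i : ℕ) ≠ 0 := by omega
      have q1 : ¬ (i : ℕ) + 1 + 1 = i := by omega
      have q2 : ¬ (i : ℕ) = i + 1 + 1 := by omega
      by_cases v1 : v = i
      · subst v1; simp [mem_bAct, ← h, hj, q1, q2]
      by_cases v2 : v = i + 1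
      · subst v2; simp [mem_bAct, ← h, hj, q1, q2]
      by_cases v3 : v = i + 1 + 1
      · subst v3; simp [mem_bAct, ← h, hj, q1, q2]
      simp [mem_bAct, ← h, hj, v1, v2, v3]
  · ext X v
    have h1' : (i : ℕ) ≠ j := fun h => h1 (Fin.ext h)
    simp only [pow_succ, pow_zero, one_mul, Equiv.Perm.mul_apply, Equiv.Perm.one_apply,
      genPerm_apply, mem_bAct]
    grind

section
variable {n : ℕ} {W : Type*} [Group W] (cs : CoxeterSystem (BCox n) W)

/-- The set `∅ · x`. -/
noncomputable def actE (x : W) : Finset ℕ :=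
  (cs.lift ⟨genPerm n, genPerm_liftable n⟩ x)⁻¹ ∅

lemma actE_one : actE cs 1 = ∅ := by simp [actE]

lemma actE_mul (x : W) (i : Fin n) : actE cs (x * cs.simple i) = bAct n (actE cs x) i := by
  unfold actE
  rw [map_mul, mul_inv_rev, CoxeterSystem.lift_apply_simple, genPerm_inv, Equiv.Perm.mul_apply,
    genPerm_apply]

lemma actE_simple_mul (x : W) (i : Fin n) (hi : (i : ℕ) ≠ 0) :
    actE cs (cs.simple i * x) = actE cs x := by
  unfold actE
  rw [map_mul, mul_inv_rev, CoxeterSystem.lift_apply_simple, genPerm_inv, Equiv.Perm.mul_apply,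
    genPerm_apply]
  simp [bAct, hi]

lemma actE_wordProd (w : List (Fin n)) : actE cs (cs.wordProd w) = w.foldl (bAct n) ∅ := by
  induction w using List.reverseRecOn with
  | nil => simp [actE_one]
  | append_singleton l a ih =>
    rw [CoxeterSystem.wordProd_append, CoxeterSystem.wordProd_singleton, actE_mul, ih]
    simp

lemma corr_actE (x : W) : corr cs x (actE cs x) := by
  obtain ⟨w, rfl⟩ := cs.wordProd_surjective x
  exact ⟨w, rfl, (actE_wordProd cs w).symm⟩

lemma foldl_sum_le (w : List (Fin n)) : (w.foldl (bAct n) ∅).sum id ≤ w.length := by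
  induction w using List.reverseRecOn with
  | nil => simp
  | append_singleton l a ih =>
    have := sum_le_succ (l.foldl (bAct n) ∅) a
    simp only [List.foldl_append, List.foldl_cons, List.foldl_nil, List.length_append,
      List.length_singleton]
    omega

lemma sum_le_length (x : W) : (actE cs x).sum id ≤ cs.length x := by
  obtain ⟨w, hw, rfl⟩ := cs.exists_isReduced x
  rw [actE_wordProd, hw]
  exact foldl_sum_le w

def Good (x : W) : Prop := cs.length x = (actE cs x).sum id

lemma good_one : Good cs 1 := by simp [Good, actE_one]

lemma Good.mem {x : W} (h : Good cs x) : x ∈ IWset cs := by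
  intro i hi
  have h1 := sum_le_length cs (cs.simple i * x)
  rw [actE_simple_mul cs x i hi, ← h] at h1
  rcases cs.length_simple_mul x i with h2 | h2 <;> omega

lemma Good.up {x : W} (h : Good cs x) {i : Fin n} (hu : UpS (actE cs x) i) :
    Good cs (x * cs.simple i) ∧ cs.length x < cs.length (x * cs.simple i) := by
  have h1 := sum_le_length cs (x * cs.simple i)
  unfold Good at *
  rw [actE_mul, sum_up hu, ← h] at *
  rcases cs.length_mul_simple x i with h2 | h2 <;> omega

lemma dn_dn {X : Finset ℕ} {i j : Fin n} (hij : i ≠ j) (hi : DnS X i) (hj : DnS X j) :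
    (BCox n).M i j = 2 ∧ DnS (bAct n X j) i := by
  have hM : (BCox n).M i j = if i = j then 1
      else if (i : ℕ) + (j : ℕ) = 1 then 4
      else if (j : ℕ) + 1 = (i : ℕ) ∨ (i : ℕ) + 1 = (j : ℕ) then 3 else 2 := rfl
  have hij' : (i : ℕ) ≠ j := fun h => hij (Fin.ext h)
  have h1 : ¬ ((i : ℕ) + (j : ℕ) = 1) := by
    intro h
    have hh : ((i : ℕ) = 0 ∧ (j : ℕ) = 1) ∨ ((i : ℕ) = 1 ∧ (j : ℕ) = 0) := by omega
    unfold DnS at hi hj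
    rcases hh with ⟨a, b⟩ | ⟨a, b⟩ <;> simp_all
  have h2 : ¬ ((j : ℕ) + 1 = (i : ℕ) ∨ (i : ℕ) + 1 = (j : ℕ)) := by
    intro h
    unfold DnS at hi hj
    rcases h with h | h
    · have : (j : ℕ) ≠ 0 := by omega
      simp_all
    · have : (i : ℕ) ≠ 0 := by omega
      simp_all
  refine ⟨by rw [hM]; simp [hij, h1, h2], ?_⟩
  unfold DnS at *
  simp only [mem_bAct]
  grind

lemma Good.dn_aux (k : ℕ) : ∀ (x : W) (i : Fin n), cs.length x = k → Good cs x →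
    DnS (actE cs x) i → Good cs (x * cs.simple i) := by
  induction k using Nat.strong_induction_on with
  | _ k ih =>
  intro x i hk h hd
  have hs := sum_dn hd
  have hx1 : x ≠ 1 := by
    rintro rfl
    rw [actE_one] at hd
    unfold DnS at hd
    split_ifs at hd <;> simp at hd
  obtain ⟨j, hj⟩ := cs.exists_rightDescent_of_ne_one hx1
  have hj1 : cs.length (x * cs.simple j) + 1 = cs.length x := by
    have : cs.length (x * cs.simple j) < cs.length x := hj
    rcases cs.length_mul_simple x j with h2 | h2 <;> omega
  have hle := sum_le_length cs (x * cs.simple j)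
  rw [actE_mul] at hle
  have hdj : DnS (actE cs x) j := dn_of_lt (by unfold Good at h; omega)
  have hsj := sum_dn hdj
  have hg : Good cs (x * cs.simple j) := by
    unfold Good at *; rw [actE_mul]; omega
  by_cases hij : i = j
  · subst hij; exact hg
  obtain ⟨hM, hdi⟩ := dn_dn hij hd hdj
  have hg2 := ih _ (by omega) (x * cs.simple j) i rfl hg (by rw [actE_mul]; exact hdi)
  have hcomm : cs.simple i * cs.simple j = cs.simple j * cs.simple i := by
    have := cs.simple_mul_simple_pow i j
    rw [hM, pow_two] at this
    have h3 := eq_inv_of_mul_eq_one_left this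
    rw [h3]; simp
  have hx : x * cs.simple i = x * cs.simple j * cs.simple i * cs.simple j := by
    rw [mul_assoc, mul_assoc, hcomm]
    simp
  have hsi := sum_dn hdi
  have e1 : cs.length (x * cs.simple j * cs.simple i) + 1 = cs.length (x * cs.simple j) := by
    unfold Good at *
    rw [hg2, hg, actE_mul, actE_mul]
    exact hsi
  have e2 := sum_le_length cs (x * cs.simple i)
  rw [actE_mul] at e2
  have e3 : cs.length (x * cs.simple i) ≤ cs.length (x * cs.simple j * cs.simple i) + 1 := by
    rw [hx]
    rcases cs.length_mul_simple (x * cs.simple j * cs.simple i) j with h2 | h2 <;> omega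
  unfold Good at *
  rw [actE_mul]
  omega

lemma Good.dn {x : W} (h : Good cs x) {i : Fin n} (hd : DnS (actE cs x) i) :
    Good cs (x * cs.simple i) ∧ ¬ cs.length x < cs.length (x * cs.simple i) := by
  have hg := Good.dn_aux cs _ x i rfl h hd
  have := sum_dn hd
  refine ⟨hg, ?_⟩
  unfold Good at *
  rw [hg, h, actE_mul]
  omega

end

/-- Abstract runs of a masked word on subsets. -/
inductive Run {n : ℕ} : Finset ℕ → List (Fin n × Bool) → Finset ℕ → ℤ → Prop
  | nil (Y) : Run Y [] Y 0
  | up1 {Y i l Z d} : UpS Y i → Run (bAct n Y i) l Z d → Run Y ((i, true) :: l) Z d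
  | up0 {Y i l Z d} : UpS Y i → Run Y l Z d → Run Y ((i, false) :: l) Z (1 + d)
  | dn0 {Y i l Z d} : DnS Y i → Run Y l Z d → Run Y ((i, false) :: l) Z (-1 + d)

lemma Run.append {n : ℕ} {Y Z V : Finset ℕ} {l₁ l₂ : List (Fin n × Bool)} {d₁ d₂ : ℤ}
    (h₁ : Run Y l₁ Z d₁) (h₂ : Run Z l₂ V d₂) : Run Y (l₁ ++ l₂) V (d₁ + d₂) := by
  induction h₁ with
  | nil => simpa using h₂
  | up1 h _ ih => exact Run.up1 h (ih h₂)
  | up0 h _ ih => rw [add_assoc]; exact Run.up0 h (ih h₂)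
  | dn0 h _ ih => rw [add_assoc]; exact Run.dn0 h (ih h₂)

lemma Run.transfer {n : ℕ} {W : Type*} [Group W] (cs : CoxeterSystem (BCox n) W)
    {Y Z : Finset ℕ} {l : List (Fin n × Bool)} {d : ℤ} (h : Run Y l Z d) :
    ∀ x : W, Good cs x → actE cs x = Y →
      IsParAux cs (IWset cs) x l ∧ defectAux cs x l = d ∧ NoDownOneAux cs x l ∧
        actE cs (subProdAux cs x l) = Z := by
  induction h with
  | nil Y => intro x _ hx; exact ⟨trivial, rfl, trivial, hx⟩
  | @up1 Y i l Z d h _ ih =>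
    intro x hg hx
    subst hx
    obtain ⟨h1, h2⟩ := hg.up cs h
    obtain ⟨a, b, c, e⟩ := ih _ h1 (actE_mul cs x i)
    refine ⟨⟨h1.mem, ?_⟩, ?_, ⟨fun _ => not_lt.mpr h2.le, ?_⟩, ?_⟩
    · simpa using a
    · simpa [defectAux] using b
    · simpa using c
    · simpa [subProdAux] using e
  | @up0 Y i l Z d h _ ih =>
    intro x hg hx
    obtain ⟨a, b, c, e⟩ := ih x hg hx
    subst hx
    obtain ⟨h1, h2⟩ := hg.up cs h
    refine ⟨⟨h1.mem, ?_⟩, ?_, ⟨by simp, ?_⟩, ?_⟩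
    · simpa using a
    · simp [defectAux, b, h2]
    · simpa using c
    · simpa [subProdAux] using e
  | @dn0 Y i l Z d h _ ih =>
    intro x hg hx
    obtain ⟨a, b, c, e⟩ := ih x hg hx
    subst hx
    obtain ⟨h1, h2⟩ := hg.dn cs h
    refine ⟨⟨h1.mem, ?_⟩, ?_, ⟨by simp, ?_⟩, ?_⟩
    · simpa using a
    · simp only [defectAux, b, h2, if_false]; simp
    · simpa using c
    · simpa [subProdAux] using e

/-! ### The combinatorial part -/

/-- Position of the particle of row `r` after column `c`. -/
def rowPos (t : ℕ → ℕ) (E : Finset ℕ) (r c : ℕ) : ℕ :=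
  if t r ∈ E ∧ 2 * r + t r < c then 0 else min (t r) (c - 2 * r)

/-- The set of positions when row `r` is at time `τ r`. -/
def stt (t : ℕ → ℕ) (E : Finset ℕ) (len : ℕ) (τ : ℕ → ℕ) : Finset ℕ :=
  ((Finset.range len).image fun r => rowPos t E r (τ r)).erase 0

lemma mem_stt {t : ℕ → ℕ} {E : Finset ℕ} {len : ℕ} {τ : ℕ → ℕ} {v : ℕ} :
    v ∈ stt t E len τ ↔ v ≠ 0 ∧ ∃ r < len, rowPos t E r (τ r) = v := by
  simp [stt]

structure Hyp (n : ℕ) (t : ℕ → ℕ) (len : ℕ) (E : Finset ℕ) : Prop where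
  dec : ∀ r s, r < s → s < len → t s < t r
  pos : ∀ r < len, 1 ≤ t r
  le : ∀ r < len, t r ≤ n
  ev : ∀ i < len, t i ∈ E → ∃ h, t i = 2 * h ∧ 1 ≤ h ∧ i + h < len ∧
    ∀ j, 1 ≤ j → j ≤ h → 2 * h + 1 ≤ t (i + j) + 2 * j

lemma Hyp.gap {n : ℕ} {t : ℕ → ℕ} {len : ℕ} {E : Finset ℕ} (H : Hyp n t len E) {i j : ℕ}
    (hij : i < j) (hj : j < len) (hi : t i ∈ E) (hj' : t j ∈ E) :
    2 * i + t i + 2 ≤ 2 * j + t j := by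
  obtain ⟨h, e1, e2, e3, e4⟩ := H.ev i (by omega) hi
  obtain ⟨h', f1, f2, f3, f4⟩ := H.ev j hj hj'
  by_cases hh : j - i ≤ h
  · have := e4 (j - i) (by omega) hh
    rw [show i + (j - i) = j by omega] at this
    omega
  · omega

/-- The (at most one) letter contributed by row `i` in column `c`. -/
def cell (n : ℕ) (t : ℕ → ℕ) (mk : ℕ → ℕ → Bool) (c i : ℕ) : Option (Fin n × Bool) :=
  if 2 * i < c ∧ c ≤ 2 * i + t i then
    (if h : c - 2 * i - 1 < n then some (⟨c - 2 * i - 1, h⟩, mk i c) else none)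
  else none

structure MaskSpec (t : ℕ → ℕ) (len : ℕ) (E : Finset ℕ) (mk : ℕ → ℕ → Bool) : Prop where
  spec : ∀ i < len, ∀ c, 2 * i < c → c ≤ 2 * i + t i → (mk i c = false ↔
    ∃ i0 ≤ i, t i0 ∈ E ∧ (c = 2 * i0 + t i0 ∨ c = 2 * i0 + t i0 + 1))

section
variable {n : ℕ} {t : ℕ → ℕ} {len : ℕ} {E : Finset ℕ} {mk : ℕ → ℕ → Bool}

lemma step_up (H : Hyp n t len E) {m c : ℕ} {τ : ℕ → ℕ} (hm : m < len) (h1 : 2 * m < c)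
    (h2 : c ≤ 2 * m + t m) (hτ : τ m = c - 1) (hlt : ∀ r < m, τ r = c)
    (hgt : ∀ r, m < r → τ r ≤ c - 1) (hl : c - 2 * m - 1 < n) :
    UpS (stt t E len τ) (⟨c - 2 * m - 1, hl⟩ : Fin n) ∧
    bAct n (stt t E len τ) ⟨c - 2 * m - 1, hl⟩ = stt t E len (fun r => if r = m then c else τ r) := by
  have p1 : rowPos t E m (c - 1) = c - 2 * m - 1 := by
    unfold rowPos; rw [if_neg (by omega)]; omega
  have p2 : rowPos t E m c = c - 2 * m := by
    unfold rowPos; rw [if_neg (by omega)]; omega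
  have p3 : ∀ r < m, rowPos t E r (τ r) = 0 ∨ c - 2 * m < rowPos t E r (τ r) := by
    intro r hr
    rw [hlt r hr]
    unfold rowPos
    have := H.dec r m hr hm
    split_ifs
    · exact Or.inl rfl
    · right; omega
  have p4 : ∀ r, m < r → rowPos t E r (τ r) = 0 ∨ rowPos t E r (τ r) < c - 2 * m - 1 := by
    intro r hr
    have := hgt r hr
    unfold rowPos
    split_ifs
    · exact Or.inl rfl
    · omega
  have q1 : c - 2 * m ∉ stt t E len τ := by
    rw [mem_stt]
    rintro ⟨_, r, hr, hv⟩
    rcases lt_trichotomy r m with h | h | h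
    · have := p3 r h; omega
    · subst h; rw [hτ] at hv; omega
    · have := p4 r h; omega
  have q2 : c - 2 * m - 1 ≠ 0 → c - 2 * m - 1 ∈ stt t E len τ := by
    intro h
    rw [mem_stt]
    exact ⟨h, m, hm, by rw [hτ, p1]⟩
  have q3 : c - 2 * m - 1 + 1 = c - 2 * m := by omega
  have hU : UpS (stt t E len τ) (⟨c - 2 * m - 1, hl⟩ : Fin n) := by
    unfold UpS
    simp only [q3]
    split_ifs with h0
    · rwa [show 1 = c - 2 * m by omega]
    · exact ⟨q2 h0, q1⟩
  refine ⟨hU, ?_⟩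
  -- membership in the new state
  have key : ∀ v, v ∈ stt t E len (fun r => if r = m then c else τ r) ↔
      (v = c - 2 * m ∨ (v ≠ c - 2 * m - 1 ∧ v ∈ stt t E len τ)) := by
    intro v
    simp only [mem_stt]
    constructor
    · rintro ⟨hv, r, hr, hrv⟩
      by_cases hrm : r = m
      · subst hrm
        simp only [if_true] at hrv
        left; omega
      · simp only [hrm, if_false] at hrv
        right
        refine ⟨?_, hv, r, hr, hrv⟩
        rcases lt_or_gt_of_ne hrm with h | h
        · have := p3 r h; omega
        · have := p4 r h; omega
    · rintro (rfl | ⟨hv1, hv, r, hr, hrv⟩)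
      · exact ⟨by omega, m, hm, by simp [p2]⟩
      · refine ⟨hv, r, hr, ?_⟩
        have : r ≠ m := by rintro rfl; rw [hτ] at hrv; omega
        simp [this, hrv]
  have z0 : (0 : ℕ) ∉ stt t E len τ := by simp [mem_stt]
  ext v
  rw [key, mem_bAct]
  simp only [q3]
  split_ifs with h0 h3 h3 h4
  · have : c - 2 * m = 1 := by omega
    rw [this] at q1 ⊢
    simp [q1, h3]
  · have : c - 2 * m = 1 := by omega
    rw [this]
    simp only [h3, false_or]
    constructor
    · intro hv; refine ⟨?_, hv⟩; rintro rfl; exact z0 hv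
    · exact fun hv => hv.2
  · simp only [q1, false_iff, not_or, not_and]
    exact ⟨by omega, fun h => absurd h3 h⟩
  · simp [q2 h0, h4]
  · simp [h3, h4]

lemma front (H : Hyp n t len E) {c k : ℕ} {τ : ℕ → ℕ} (hk : k ≤ len)
    (h1 : ∀ r < k, τ r = c - 1) (h2 : ∀ r, k ≤ r → τ r ≤ c - 1)
    (hmk : ∀ r < k, 2 * r < c → c ≤ 2 * r + t r → mk r c = true)
    (hne : ∀ r < k, t r ∈ E → 2 * r + t r + 1 ≠ c) :
    ∀ m ≤ k, Run (stt t E len τ) ((List.range m).filterMap (cell n t mk c))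
      (stt t E len (fun r => if r < m then c else τ r)) 0 := by
  intro m
  induction m with
  | zero => intro _; simpa using Run.nil _
  | succ m ih =>
    intro hm
    have ih' := ih (by omega)
    rw [List.range_succ, List.filterMap_append]
    rw [show (0 : ℤ) = 0 + 0 by ring]
    refine ih'.append ?_
    have hfun : (fun r => if r < m + 1 then c else τ r) =
        (fun r => if r = m then c else (fun r => if r < m then c else τ r) r) := by
      funext r
      by_cases hr : r = m
      · simp [hr]
      · have : r < m + 1 ↔ r < m := by omega
        simp [hr, this]
    by_cases hb : 2 * m < c ∧ c ≤ 2 * m + t m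
    · have hl : c - 2 * m - 1 < n := by
        have := H.le m (by omega); omega
      have hcell : cell n t mk c m = some (⟨c - 2 * m - 1, hl⟩, true) := by
        unfold cell
        rw [if_pos hb, dif_pos hl, hmk m (by omega) hb.1 hb.2]
      have := step_up (τ := fun r => if r < m then c else τ r) H (by omega : m < len) hb.1 hb.2
        (by simp [h1 m (by omega)]) (by intro r hr; simp [hr])
        (by
          intro r hr
          have : ¬ r < m := by omega
          simp only [this, if_false]
          by_cases hrk : r < k
          · exact (h1 r hrk).le
          · exact h2 r (by omega)) hl
      obtain ⟨u1, u2⟩ := this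
      rw [hfun, ← u2]
      simp only [List.filterMap_cons, List.filterMap_nil, hcell]
      exact Run.up1 u1 (Run.nil _)
    · have hcell : cell n t mk c m = none := by
        unfold cell
        rw [if_neg hb]
      simp only [List.filterMap_cons, List.filterMap_nil, hcell]
      have heq : stt t E len (fun r => if r < m + 1 then c else τ r) =
          stt t E len (fun r => if r < m then c else τ r) := by
        have hrow : rowPos t E m c = rowPos t E m (c - 1) := by
          have h3 := hne m (by omega)
          have h4 := H.pos m (by omega)
          unfold rowPos
          by_cases hE : t m ∈ E
          · have := h3 hE
            simp only [hE, true_and]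
            split_ifs <;> omega
          · simp only [hE, false_and, if_false]; omega
        unfold stt
        congr 1
        apply Finset.image_congr
        intro r _
        by_cases hr : r = m
        · subst hr; simp [hrow, h1 r (by omega)]
        · have : r < m + 1 ↔ r < m := by omega
          simp [this]
      rw [heq]
      exact Run.nil _

lemma val1 (H : Hyp n t len E) {i0 h : ℕ} (hi : i0 < len) (hE : t i0 ∈ E) (hh : t i0 = 2 * h)
    {r : ℕ} (hr : i0 ≤ r) (hrl : r < len) :
    rowPos t E r (2 * i0 + 2 * h - 1) = 2 * i0 + 2 * h - 1 - 2 * r := by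
  obtain ⟨h', e1, e2, e3, e4⟩ := H.ev i0 hi hE
  have : h' = h := by omega
  subst this
  rcases eq_or_lt_of_le hr with rfl | hr
  · unfold rowPos; rw [if_neg (by omega)]; omega
  · by_cases hle : r - i0 ≤ h'
    · have := e4 (r - i0) (by omega) hle
      rw [show i0 + (r - i0) = r by omega] at this
      unfold rowPos; rw [if_neg (by omega)]; omega
    · unfold rowPos; split_ifs <;> omega

lemma val2 (H : Hyp n t len E) {i0 c : ℕ} (hi : i0 < len)
    (hc : 2 * i0 + t i0 ≤ c) {r : ℕ} (hr : r < i0) :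
    rowPos t E r c = 0 ∨ t i0 < rowPos t E r c := by
  have := H.dec r i0 hr hi
  unfold rowPos
  split_ifs
  · exact Or.inl rfl
  · right; omega

lemma val3 (H : Hyp n t len E) {i0 h : ℕ} (hi : i0 < len) (hE : t i0 ∈ E) (hh : t i0 = 2 * h)
    {r : ℕ} (hr : i0 < r) (hrl : r < len) :
    rowPos t E r (2 * i0 + 2 * h + 1) = 2 * i0 + 2 * h + 1 - 2 * r := by
  obtain ⟨h', e1, e2, e3, e4⟩ := H.ev i0 hi hE
  have : h' = h := by omega
  subst this
  have hnd : ¬ (t r ∈ E ∧ 2 * r + t r < 2 * i0 + 2 * h' + 1) := by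
    rintro ⟨a, b⟩
    have := H.gap hr hrl hE a
    omega
  unfold rowPos; rw [if_neg hnd]
  by_cases hle : r - i0 ≤ h'
  · have := e4 (r - i0) (by omega) hle
    rw [show i0 + (r - i0) = r by omega] at this
    omega
  · omega

/-- State in the middle of the event at row `i0`. -/
lemma mem_mid (H : Hyp n t len E) {i0 h c : ℕ} (hi : i0 < len) (hE : t i0 ∈ E)
    (hh : t i0 = 2 * h) (hc : 2 * i0 + 2 * h ≤ c) {v : ℕ} (hv : v ≤ 2 * h) :
    v ∈ stt t E len (fun r => if r < i0 then c else 2 * i0 + 2 * h - 1) ↔ v % 2 = 1 := by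
  obtain ⟨h', e1, e2, e3, e4⟩ := H.ev i0 hi hE
  have : h' = h := by omega
  subst this
  rw [mem_stt]
  constructor
  · rintro ⟨hv0, r, hr, hrv⟩
    by_cases hri : r < i0
    · simp only [hri, if_true] at hrv
      have := val2 (E := E) H hi (by omega : 2 * i0 + t i0 ≤ c) hri
      omega
    · simp only [hri, if_false] at hrv
      rw [val1 H hi hE hh (by omega) hr] at hrv
      omega
  · intro hodd
    refine ⟨by omega, i0 + (2 * h' - 1 - v) / 2, by omega, ?_⟩
    have : ¬ i0 + (2 * h' - 1 - v) / 2 < i0 := by omega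
    simp only [this, if_false]
    rw [val1 H hi hE hh (by omega) (by omega)]
    omega

lemma frozenB (H : Hyp n t len E) (M : MaskSpec t len E mk) {i0 h : ℕ} (hi : i0 < len)
    (hE : t i0 ∈ E) (hh : t i0 = 2 * h) {Y : Finset ℕ}
    (hY : ∀ v ≤ 2 * h, v ∈ Y ↔ v % 2 = 1) :
    ∀ j, i0 + j ≤ len → Run Y ((List.range' i0 j).filterMap (cell n t mk (2 * i0 + 2 * h))) Y
      ((min j h : ℕ) : ℤ) := by
  obtain ⟨h', e1, e2, e3, e4⟩ := H.ev i0 hi hE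
  have : h' = h := by omega
  subst this
  intro j
  induction j with
  | zero => intro _; simpa using Run.nil _
  | succ j ih =>
    intro hj
    rw [List.range'_concat, List.filterMap_append, one_mul]
    simp only [List.filterMap_cons, List.filterMap_nil]
    by_cases hb : j < h'
    · have hbox : 2 * (i0 + j) < 2 * i0 + 2 * h' ∧ 2 * i0 + 2 * h' ≤ 2 * (i0 + j) + t (i0 + j) := by
        refine ⟨by omega, ?_⟩
        rcases Nat.eq_zero_or_pos j with rfl | h0
        · simp; omega
        · have := e4 j h0 (by omega); omega
      have hl : 2 * i0 + 2 * h' - 2 * (i0 + j) - 1 < n := by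
        have := H.le i0 hi; omega
      have hm : mk (i0 + j) (2 * i0 + 2 * h') = false :=
        (M.spec _ (by omega) _ hbox.1 hbox.2).2 ⟨i0, by omega, hE, by omega⟩
      have hcell : cell n t mk (2 * i0 + 2 * h') (i0 + j) =
          some (⟨2 * i0 + 2 * h' - 2 * (i0 + j) - 1, hl⟩, false) := by
        unfold cell
        rw [if_pos hbox, dif_pos hl, hm]
      rw [hcell]
      rw [show ((min (j + 1) h' : ℕ) : ℤ) = ((min j h' : ℕ) : ℤ) + (1 + 0) by omega]
      refine (ih (by omega)).append (Run.up0 ?_ (Run.nil _))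
      unfold UpS
      simp only
      rw [if_neg (by omega), hY _ (by omega), hY _ (by omega)]
      omega
    · have hcell : cell n t mk (2 * i0 + 2 * h') (i0 + j) = none := by
        unfold cell
        rw [if_neg (by omega)]
      rw [hcell]
      rw [show ((min (j + 1) h' : ℕ) : ℤ) = ((min j h' : ℕ) : ℤ) + 0 by omega]
      exact (ih (by omega)).append (Run.nil _)

lemma frozenC (H : Hyp n t len E) (M : MaskSpec t len E mk) {i0 h : ℕ} (hi : i0 < len)
    (hE : t i0 ∈ E) (hh : t i0 = 2 * h) {Y : Finset ℕ}
    (hY : ∀ v ≤ 2 * h, v ∈ Y ↔ v % 2 = 1) :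
    ∀ j, i0 + j ≤ len → Run Y ((List.range' i0 j).filterMap (cell n t mk (2 * i0 + 2 * h + 1))) Y
      (-((min (j - 1) h : ℕ) : ℤ)) := by
  obtain ⟨h', e1, e2, e3, e4⟩ := H.ev i0 hi hE
  have : h' = h := by omega
  subst this
  intro j
  induction j with
  | zero => intro _; simpa using Run.nil _
  | succ j ih =>
    intro hj
    rw [List.range'_concat, List.filterMap_append, one_mul]
    simp only [List.filterMap_cons, List.filterMap_nil]
    by_cases hb : 1 ≤ j ∧ j ≤ h'
    · have hbox : 2 * (i0 + j) < 2 * i0 + 2 * h' + 1 ∧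
          2 * i0 + 2 * h' + 1 ≤ 2 * (i0 + j) + t (i0 + j) := by
        refine ⟨by omega, ?_⟩
        have := e4 j hb.1 hb.2; omega
      have hl : 2 * i0 + 2 * h' + 1 - 2 * (i0 + j) - 1 < n := by
        have := H.le i0 hi; omega
      have hm : mk (i0 + j) (2 * i0 + 2 * h' + 1) = false :=
        (M.spec _ (by omega) _ hbox.1 hbox.2).2 ⟨i0, by omega, hE, by omega⟩
      have hcell : cell n t mk (2 * i0 + 2 * h' + 1) (i0 + j) =
          some (⟨2 * i0 + 2 * h' + 1 - 2 * (i0 + j) - 1, hl⟩, false) := by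
        unfold cell
        rw [if_pos hbox, dif_pos hl, hm]
      rw [hcell]
      rw [show (-((min (j + 1 - 1) h' : ℕ) : ℤ)) = -((min (j - 1) h' : ℕ) : ℤ) + (-1 + 0) by omega]
      refine (ih (by omega)).append (Run.dn0 ?_ (Run.nil _))
      unfold DnS
      simp only
      split_ifs with h0
      · rw [hY _ (by omega)]
      · rw [hY _ (by omega), hY _ (by omega)]
        omega
    · have hcell : cell n t mk (2 * i0 + 2 * h' + 1) (i0 + j) = none := by
        unfold cell
        rw [if_neg]
        rintro ⟨a, b⟩
        have : j = 0 := by omega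
        subst this
        simp only [add_zero] at b
        omega
      rw [hcell]
      rw [show (-((min (j + 1 - 1) h' : ℕ) : ℤ)) = -((min (j - 1) h' : ℕ) : ℤ) + 0 by omega]
      exact (ih (by omega)).append (Run.nil _)

lemma range_split {i0 : ℕ} (hi : i0 ≤ len) :
    List.range len = List.range i0 ++ List.range' i0 (len - i0) := by
  rw [List.range_eq_range', List.range_eq_range']
  have := List.range'_append (s := 0) (m := i0) (n := len - i0) (step := 1)
  simp only [one_mul, zero_add] at this
  rw [this]
  congr 1; omega

lemma stt_congr {τ τ' : ℕ → ℕ} (h : ∀ r < len, rowPos t E r (τ r) = rowPos t E r (τ' r)) :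
    stt t E len τ = stt t E len τ' := by
  unfold stt
  congr 1
  apply Finset.image_congr
  intro r hr
  exact h r (by simpa using hr)

lemma end_event (H : Hyp n t len E) {i0 h : ℕ} (hi : i0 < len)
    (hE : t i0 ∈ E) (hh : t i0 = 2 * h) :
    stt t E len (fun r => if r < i0 then 2 * i0 + 2 * h + 1 else 2 * i0 + 2 * h - 1) =
      stt t E len (fun _ => 2 * i0 + 2 * h + 1) := by
  obtain ⟨h', e1, e2, e3, e4⟩ := H.ev i0 hi hE
  have : h' = h := by omega
  subst this
  ext v
  simp only [mem_stt]
  constructor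
  · rintro ⟨hv, r, hr, hrv⟩
    refine ⟨hv, ?_⟩
    by_cases hri : r < i0
    · simp only [hri, if_true] at hrv
      exact ⟨r, hr, hrv⟩
    · simp only [hri, if_false] at hrv
      rw [val1 H hi hE hh (by omega) hr] at hrv
      refine ⟨r + 1, by omega, ?_⟩
      rw [val3 H hi hE hh (by omega) (by omega)]
      omega
  · rintro ⟨hv, r, hr, hrv⟩
    refine ⟨hv, ?_⟩
    by_cases hri : r < i0
    · exact ⟨r, hr, by simpa [hri] using hrv⟩
    · have hne : r ≠ i0 := by
        rintro rfl
        unfold rowPos at hrv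
        rw [if_pos ⟨hE, by omega⟩] at hrv
        omega
      rw [val3 H hi hE hh (by omega) (by omega)] at hrv
      refine ⟨r - 1, by omega, ?_⟩
      have : ¬ r - 1 < i0 := by omega
      simp only [this, if_false]
      rw [val1 H hi hE hh (by omega) (by omega)]
      omega

lemma columns (H : Hyp n t len E) (M : MaskSpec t len E mk) (c : ℕ) :
    (∀ i0 < len, t i0 ∈ E → c = 2 * i0 + t i0 →
      Run ∅ ((List.range' 1 c).flatMap fun c => (List.range len).filterMap (cell n t mk c))
        (stt t E len (fun r => if r < i0 then c else c - 1)) ((t i0 / 2 : ℕ) : ℤ)) ∧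
    ((∀ i0 < len, t i0 ∈ E → c ≠ 2 * i0 + t i0) →
      Run ∅ ((List.range' 1 c).flatMap fun c => (List.range len).filterMap (cell n t mk c))
        (stt t E len (fun _ => c)) 0) := by
  induction c with
  | zero =>
    constructor
    · intro i0 hi hE h0
      have := H.pos i0 hi
      omega
    · intro _
      have : stt t E len (fun _ => 0) = ∅ := by
        ext v
        simp only [mem_stt, Finset.notMem_empty, iff_false]
        rintro ⟨hv, r, hr, hrv⟩
        unfold rowPos at hrv
        rw [if_neg (by omega)] at hrv
        omega
      rw [this]
      simpa using Run.nil _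
  | succ c ih =>
    obtain ⟨ihB, ihA⟩ := ih
    simp only [List.range'_concat, List.flatMap_append, List.flatMap_cons, List.flatMap_nil,
      List.append_nil, one_mul, add_comm 1 c]
    constructor
    · intro i0 hi hE hc
      obtain ⟨h, e1, e2, e3, e4⟩ := H.ev i0 hi hE
      have hno : ∀ i < len, t i ∈ E → c ≠ 2 * i + t i := by
        intro i hil hiE hci
        rcases lt_trichotomy i i0 with h | h | h
        · have := H.gap h hi hiE hE; omega
        · subst h; omega
        · have := H.gap h hil hE hiE; omega
      rw [show ((t i0 / 2 : ℕ) : ℤ) = 0 + (0 + ((min (len - i0) h : ℕ) : ℤ)) by omega]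
      refine (ihA hno).append ?_
      rw [range_split hi.le, List.filterMap_append]
      have hf := front (mk := mk) (τ := fun _ => c) (c := c + 1) H hi.le (by simp) (by simp)
        (by
          intro r hr b1 b2
          by_contra hmk
          obtain ⟨i, a1, a2, a3⟩ := (M.spec r (by omega) _ b1 b2).1 (by simpa using hmk)
          have := H.gap (by omega : i < i0) hi a2 hE
          omega)
        (by
          intro r hr hrE
          have := hno r (by omega) hrE
          omega) i0 le_rfl
      refine hf.append ?_
      have hfun : (fun r => if r < i0 then c + 1 else c) =
        (fun r => if r < i0 then c + 1 else 2 * i0 + 2 * h - 1) := by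
        funext r; split_ifs <;> omega
      simp only [Nat.add_sub_cancel]
      have hY := fun v hv => mem_mid (v := v) (c := c + 1) H hi hE e1 (by omega) hv
      rw [hfun, show c + 1 = 2 * i0 + 2 * h by omega]
      rw [show c + 1 = 2 * i0 + 2 * h by omega] at hY
      exact frozenB H M hi hE e1 hY _ (by omega)
    · intro hno
      by_cases hev : ∃ i0 < len, t i0 ∈ E ∧ c = 2 * i0 + t i0
      · obtain ⟨i0, hi, hE, hc⟩ := hev
        obtain ⟨h, e1, e2, e3, e4⟩ := H.ev i0 hi hE
        rw [show (0 : ℤ) = ((t i0 / 2 : ℕ) : ℤ) + (0 + -((min (len - i0 - 1) h : ℕ) : ℤ)) by omega]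
        refine (ihB i0 hi hE hc).append ?_
        rw [range_split hi.le, List.filterMap_append]
        have hf := front (mk := mk) (τ := fun r => if r < i0 then c else c - 1) (c := c + 1) H
          hi.le (by intro r hr; simp [hr]) (by intro r hr; have : ¬ r < i0 := by omega
                                               simp [this])
          (by
            intro r hr b1 b2
            by_contra hmk
            obtain ⟨i, a1, a2, a3⟩ := (M.spec r (by omega) _ b1 b2).1 (by simpa using hmk)
            have := H.gap (by omega : i < i0) hi a2 hE
            omega)
          (by
            intro r hr hrE
            have := H.gap hr hi hrE hE
            omega) i0 le_rfl
        refine hf.append ?_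
        have hfun : (fun r => if r < i0 then c + 1 else (if r < i0 then c else c - 1)) =
          (fun r => if r < i0 then 2 * i0 + 2 * h + 1 else 2 * i0 + 2 * h - 1) := by
          funext r; split_ifs <;> omega
        have hY := fun v hv =>
          mem_mid (v := v) (c := 2 * i0 + 2 * h + 1) H hi hE e1 (by omega) hv
        rw [hfun, show c + 1 = 2 * i0 + 2 * h + 1 by omega, ← end_event H hi hE e1]
        exact frozenC H M hi hE e1 hY _ (by omega)
      · push Not at hev
        rw [show (0 : ℤ) = 0 + 0 by ring]
        refine (ihA hev).append ?_
        have hf := front (mk := mk) (τ := fun _ => c) (c := c + 1) H le_rfl (by simp) (by simp)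
          (by
            intro r hr b1 b2
            by_contra hmk
            obtain ⟨i, a1, a2, a3⟩ := (M.spec r (by omega) _ b1 b2).1 (by simpa using hmk)
            have := hno i (by omega) a2
            have := hev i (by omega) a2
            omega)
          (by
            intro r hr hrE
            have := hev r hr hrE
            omega) len le_rfl
        rw [stt_congr (τ := fun r => if r < len then c + 1 else c) (τ' := fun _ => c + 1)] at hf
        · exact hf
        · intro r hr; simp [hr]

end

/-! ### Assembling -/

lemma zip_aux (n : ℕ) (mk : ℕ → ℕ → Bool) (bs : List (ℕ × ℕ)) :
    (bs.filterMap fun b => if h : b.2 - 2 * b.1 - 1 < n then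
        some (⟨b.2 - 2 * b.1 - 1, h⟩ : Fin n) else none).zip
      (bs.filterMap fun b => if b.2 - 2 * b.1 - 1 < n then some (mk b.1 b.2) else none) =
    bs.filterMap fun b => if h : b.2 - 2 * b.1 - 1 < n then
        some ((⟨b.2 - 2 * b.1 - 1, h⟩ : Fin n), mk b.1 b.2) else none := by
  induction bs with
  | nil => rfl
  | cons b bs ih =>
    by_cases h : b.2 - 2 * b.1 - 1 < n
    · simp [h, ih]
    · simp [h, ih]

lemma len_aux (n : ℕ) (mk : ℕ → ℕ → Bool) (bs : List (ℕ × ℕ)) :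
    (bs.filterMap fun b => if b.2 - 2 * b.1 - 1 < n then some (mk b.1 b.2) else none).length =
    (bs.filterMap fun b => if h : b.2 - 2 * b.1 - 1 < n then
        some (⟨b.2 - 2 * b.1 - 1, h⟩ : Fin n) else none).length := by
  induction bs with
  | nil => rfl
  | cons b bs ih =>
    by_cases h : b.2 - 2 * b.1 - 1 < n
    · simp [h, ih]
    · simp [h, ih]

lemma zip_eq (n : ℕ) (T : List ℕ) (E : Finset ℕ) :
    (colWord n T).zip (colMask n T E) =
      (List.range' 1 (2 * T.length + T.headD 0)).flatMap fun c =>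
        (List.range T.length).filterMap (cell n (fun i => T.getD i 0)
          (fun i c => decide ¬ ∃ t ∈ E, InShape T t i c) c) := by
  unfold colWord colMask
  rw [zip_aux n (fun i c => decide ¬ ∃ t ∈ E, InShape T t i c)]
  unfold boxes
  rw [List.filterMap_flatMap]
  congr 1
  funext c
  rw [List.filterMap_filterMap]
  congr 1
  funext i
  unfold cell
  by_cases h : 2 * i < c ∧ c ≤ 2 * i + T.getD i 0
  · rw [if_pos h, if_pos h]; rfl
  · rw [if_neg h, if_neg h]; rfl

lemma getD_dec {T : List ℕ} (hT : T.Chain' (· > ·)) (r s : ℕ) (hrs : r < s) (hs : s < T.length) :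
    T.getD s 0 < T.getD r 0 := by
  have hp : T.Pairwise (· > ·) := List.isChain_iff_pairwise.1 hT
  have := List.pairwise_iff_getElem.1 hp r s (by omega) hs hrs
  rw [List.getD_eq_getElem _ _ hs, List.getD_eq_getElem _ _ (by omega : r < T.length)]
  exact this

lemma getD_mem {T : List ℕ} {r : ℕ} (hr : r < T.length) : T.getD r 0 ∈ T := by
  rw [List.getD_eq_getElem _ _ hr]
  exact List.getElem_mem hr

lemma mem_getD {T : List ℕ} {v : ℕ} (hv : v ∈ T) : ∃ r < T.length, T.getD r 0 = v := by
  obtain ⟨r, hr, rfl⟩ := List.mem_iff_getElem.1 hv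
  exact ⟨r, hr, List.getD_eq_getElem _ _ hr⟩

lemma hyp_of {n : ℕ} {T : List ℕ} (hT : T.Chain' (· > ·)) (hmem : ∀ t ∈ T, t ∈ Finset.Icc 1 n)
    {E : Finset ℕ} (hE : E ⊆ Eset n T.toFinset) : Hyp n (fun i => T.getD i 0) T.length E where
  dec := getD_dec hT
  pos r hr := (Finset.mem_Icc.1 (hmem _ (getD_mem hr))).1
  le r hr := (Finset.mem_Icc.1 (hmem _ (getD_mem hr))).2
  ev i hi hiE := by
    classical
    have h1 := hE hiE
    unfold Eset at h1
    replace h1 := (@Finset.mem_filter _ _ (_) _ _).1 h1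
    obtain ⟨_, ⟨h, hh⟩, hcond⟩ := h1
    have hb := Finset.mem_Icc.1 (hmem _ (getD_mem hi))
    have key : ∀ j, 1 ≤ j → j ≤ h → 2 * h + 1 ≤ T.getD (i + j) 0 + 2 * j := by
      intro j j1 jh
      by_contra hcon
      have hc := hcond (2 * h - 2 * j + 1) (by rw [Finset.mem_Ico]; omega)
      set A := T.toFinset.filter fun t' => 2 * h - 2 * j + 1 ≤ t' ∧ t' < T.getD i 0 with hA
      set B := (Finset.Icc 1 n \ T.toFinset).filter
        fun t' => 2 * h - 2 * j + 1 ≤ t' ∧ t' < T.getD i 0 with hB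
      have hc' : B.card < A.card := by convert hc
      have hAc : A.card ≤ j - 1 := by
        have hsub : A ⊆ (Finset.Ico (i + 1) (i + j)).image fun r => T.getD r 0 := by
          intro v hv
          rw [hA, Finset.mem_filter, List.mem_toFinset] at hv
          obtain ⟨hvT, v1, v2⟩ := hv
          obtain ⟨r, hr, rfl⟩ := mem_getD hvT
          rw [Finset.mem_image]
          refine ⟨r, ?_, rfl⟩
          rw [Finset.mem_Ico]
          constructor
          · by_contra hri
            rcases eq_or_lt_of_le (by omega : r ≤ i) with rfl | hlt
            · omega
            · have := getD_dec hT r i hlt hi; omega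
          · by_contra hri
            rcases eq_or_lt_of_le (by omega : i + j ≤ r) with rfl | hlt
            · omega
            · have := getD_dec hT _ _ hlt hr; omega
        have := (Finset.card_le_card hsub).trans Finset.card_image_le
        rw [Nat.card_Ico] at this
        omega
      have hAB : 2 * j - 1 ≤ A.card + B.card := by
        have hsub : Finset.Ico (2 * h - 2 * j + 1) (T.getD i 0) ⊆ A ∪ B := by
          intro v hv
          rw [Finset.mem_Ico] at hv
          rw [Finset.mem_union, hA, hB, Finset.mem_filter, Finset.mem_filter, Finset.mem_sdiff,
            Finset.mem_Icc]
          by_cases hvT : v ∈ T.toFinset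
          · exact Or.inl ⟨hvT, hv⟩
          · exact Or.inr ⟨⟨⟨by omega, by omega⟩, hvT⟩, hv⟩
        have := (Finset.card_le_card hsub).trans (Finset.card_union_le _ _)
        rw [Nat.card_Ico] at this
        omega
      omega
    refine ⟨h, by omega, by omega, ?_, key⟩
    by_contra hlen
    have := key h (by omega) le_rfl
    rw [List.getD_eq_default _ _ (by omega)] at this
    omega

lemma inShape_col {T : List ℕ} {t i c : ℕ} (ht : Even t) (h : InShape T t i c) :
    ∃ i0 < T.length, T.getD i0 0 = t ∧ i0 ≤ i ∧ (c = 2 * i0 + t ∨ c = 2 * i0 + t + 1) := by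
  obtain ⟨k, rfl⟩ := ht
  obtain ⟨i0, hi0, e, h⟩ := h
  refine ⟨i0, by simpa using hi0, e, ?_⟩
  omega

lemma even_of_mem {n : ℕ} {X : Finset ℕ} {t : ℕ} (h : t ∈ Eset n X) : Even t := by
  unfold Eset at h
  exact ((@Finset.mem_filter _ _ (_) _ _).1 h).2.1

lemma mask_of {n : ℕ} {T : List ℕ} (hT : T.Chain' (· > ·)) (hmem : ∀ t ∈ T, t ∈ Finset.Icc 1 n)
    {E : Finset ℕ} (hE : E ⊆ Eset n T.toFinset) :
    MaskSpec (fun i => T.getD i 0) T.length E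
      (fun i c => decide ¬ ∃ t ∈ E, InShape T t i c) where
  spec i hi c h1 h2 := by
    simp only [decide_eq_false_iff_not, not_not]
    constructor
    · rintro ⟨t, htE, hs⟩
      obtain ⟨i0, a, rfl, b, d⟩ := inShape_col (even_of_mem (hE htE)) hs
      exact ⟨i0, b, htE, d⟩
    · rintro ⟨i0, a, b, d⟩
      refine ⟨_, b, i0, by simpa using (by omega : i0 < T.length), rfl, ?_⟩
      obtain ⟨k, hk⟩ := even_of_mem (hE b)
      rcases eq_or_lt_of_le a with rfl | a
      · omega
      · omega

lemma final_state {n : ℕ} {T : List ℕ} (hT : T.Chain' (· > ·))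
    (hmem : ∀ t ∈ T, t ∈ Finset.Icc 1 n) {E : Finset ℕ} {N : ℕ}
    (hN : ∀ r < T.length, 2 * r + T.getD r 0 < N) :
    stt (fun i => T.getD i 0) E T.length (fun _ => N) = T.toFinset \ E := by
  ext v
  rw [mem_stt, Finset.mem_sdiff, List.mem_toFinset]
  constructor
  · rintro ⟨hv, r, hr, hrv⟩
    have := hN r hr
    unfold rowPos at hrv
    simp only at hrv
    split_ifs at hrv with h
    · omega
    · have hv' : T.getD r 0 = v := by omega
      rw [← hv']
      exact ⟨getD_mem hr, fun hh => h ⟨hh, this⟩⟩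
  · rintro ⟨hvT, hvE⟩
    have hv := (Finset.mem_Icc.1 (hmem _ hvT)).1
    obtain ⟨r, hr, rfl⟩ := mem_getD hvT
    refine ⟨by omega, r, hr, ?_⟩
    have := hN r hr
    unfold rowPos
    simp only
    rw [if_neg (fun hh => hvE hh.1)]
    omega

/-- Let `X ⊆ [n]`, let `x` be the element of `ᴵW` corresponding to `X`, and
let `E ⊆ E(X)`. Then the 1-2-1 shapes of distinct elements of `E(X)` are pairwise disjoint
sets of boxes of the shifted tableau of `X`, so the subexpression `e(E)` of the column reduced
expression of `X` is well defined. The subexpression `e(E)` is `I`-parabolic, has defect `0`,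
and has no position `p` with `e_p = 1` and `ℓ(x_{p−1}σ_p) < ℓ(x_{p−1})`; moreover its product
is the element of `ᴵW` corresponding to `X ∖ E`. -/
theorem stmt_7 (n : ℕ) (hn : 2 ≤ n) {W : Type*} [Group W] (cs : CoxeterSystem (BCox n) W)
    (T : List ℕ) (hT : T.Chain' (· > ·)) (hmem : ∀ t ∈ T, t ∈ Finset.Icc 1 n)
    (x : W) (hx : x ∈ IWset cs) (hcorr : corr cs x T.toFinset)
    (E : Finset ℕ) (hE : E ⊆ Eset n T.toFinset) :
    (∀ t ∈ Eset n T.toFinset, ∀ t' ∈ Eset n T.toFinset, t ≠ t' →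
      ∀ i c : ℕ, ¬(InShape T t i c ∧ InShape T t' i c)) ∧
    (colMask n T E).length = (colWord n T).length ∧
    IsPara cs (IWset cs) (colWord n T) (colMask n T E) ∧
    defect cs (colWord n T) (colMask n T E) = 0 ∧
    NoDownOne cs (colWord n T) (colMask n T E) ∧
    corr cs (subProd cs (colWord n T) (colMask n T E)) (T.toFinset \ E) := by
  have hbound : ∀ r < T.length, 2 * r + T.getD r 0 < 2 * T.length + T.headD 0 := by
    intro r hr
    have h0 : T.headD 0 = T.getD 0 0 := by cases T <;> simp
    rw [h0]
    rcases Nat.eq_zero_or_pos r with rfl | hpos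
    · omega
    · have := getD_dec hT 0 r hpos hr; omega
  have H := hyp_of hT hmem hE
  have M := mask_of hT hmem hE
  have hrun := (columns H M (2 * T.length + T.headD 0)).2 (by
    intro i0 hi _ hc
    have := hbound i0 hi
    omega)
  rw [final_state hT hmem hbound, ← zip_eq] at hrun
  obtain ⟨a, b, c, d⟩ := hrun.transfer cs 1 (good_one cs) (actE_one cs)
  refine ⟨?_, ?_, a, b, c, ?_⟩
  · rintro t ht t' ht' hne i c ⟨h1, h2⟩
    have HX := hyp_of hT hmem (Finset.Subset.refl (Eset n T.toFinset))
    obtain ⟨i0, a1, rfl, a3, a4⟩ := inShape_col (even_of_mem ht) h1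
    obtain ⟨i1, b1, rfl, b3, b4⟩ := inShape_col (even_of_mem ht') h2
    rcases lt_trichotomy i0 i1 with h | h | h
    · have := HX.gap h b1 ht ht'
      omega
    · subst h; exact hne rfl
    · have := HX.gap h a1 ht' ht
      omega
  · unfold colMask colWord
    exact len_aux n (fun i c => decide ¬ ∃ t ∈ E, InShape T t i c) (boxes T)
  · unfold subProd
    rw [← d]
    exact corr_actE cs _
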